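/- Let ŭ1 < 0 < ū1 with ū1 ≤ −ŭ1, let ŭ2 < 0, t̄ ∈ ℝ, t̂ = t̄ − π/(ū1 − ŭ1), z2 ∈ ℝ, z4 > 0. Let x: [t̂, t̄] → ℝ⁴ be the solution of the robot dynamics with constant input u = (ū1, ŭ2) and terminal condition x(t̄) = (1, z2, π/2, z4), and let λ: [t̂, t̄] → ℝ⁴ be the solution of the adjoint equation along x with λ(t̄) = (1, 0, 0, 0), i.e., λ1 ≡ 1, λ2 ≡ 0, λ3(t) = −∫_t^t̄ x4(s)·sin(x3(s)) ds, λ4(t) = ∫_t^t̄ cos(x3(s)) ds. Then λ3(t) < 0 and λ4(t) > 0 for all t ∈ (t̂, t̄); hence the input (ū1, ŭ2) minimizes the Hamiltonian λ(t)ᵀ f(x(t), u) over u ∈ [ŭ1, ū1] × [ŭ2, ū2] for every t ∈ (t̂, t̄). -/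

import Mathlib

open Set intervalIntegral

/-- The robot vector field f(x,u) = (x₄ cos x₃, x₄ sin x₃, u₁, u₂) on ℝ⁴ = ℝ×ℝ×ℝ×ℝ. -/
noncomputable def robotF (x : ℝ × ℝ × ℝ × ℝ) (u : ℝ × ℝ) : ℝ × ℝ × ℝ × ℝ :=
  (x.2.2.2 * Real.cos x.2.2.1, x.2.2.2 * Real.sin x.2.2.1, u.1, u.2)

/-- A function with constant derivative `c` on `[a, b]` is affine there. -/
theorem eq_add_mul_of_hasDerivAt_const {f : ℝ → ℝ} {a b c : ℝ}
    (hf : ∀ t ∈ Icc a b, HasDerivAt f c t) {t : ℝ} (ht : t ∈ Icc a b) :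
    f t = f b + c * (t - b) := by
  have hg : ∀ s ∈ Icc a b, HasDerivAt (fun r => f r - c * r) 0 s := fun s hs => by
    simpa using (hf s hs).fun_sub ((hasDerivAt_id' s).const_mul c)
  have hconst := constant_of_has_deriv_right_zero
    (fun s hs => (hg s hs).continuousAt.continuousWithinAt)
    (fun s hs => (hg s (Ico_subset_Icc_self hs)).hasDerivWithinAt)
  have h1 := hconst t ht
  have h2 := hconst b ⟨ht.1.trans ht.2, le_rfl⟩
  linarith

/-- Along the barrier curve with constant input (ū₁, ŭ₂) ending at (1, z₂, π/2, z₄),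
z₄ > 0, the adjoint solution λ₁ ≡ 1, λ₂ ≡ 0, λ₃(t) = −∫ₜ^t̄ x₄ sin x₃ ds,
λ₄(t) = ∫ₜ^t̄ cos x₃ ds satisfies λ₃(t) < 0 and λ₄(t) > 0 on (t̂, t̄); hence the input
(ū₁, ŭ₂) minimizes the Hamiltonian λ(t)ᵀ f(x(t), u) over u ∈ [ŭ₁,ū₁] × [ŭ₂,ū₂] there. -/
theorem barrier_input_minimizes_hamiltonian (u1lo u1hi u2lo u2hi : ℝ)
    (h1lo : u1lo < 0) (h1hi : 0 < u1hi) (hsym : u1hi ≤ -u1lo)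
    (h2lo : u2lo < 0) (h2hi : 0 < u2hi)
    (tbar z2 z4 : ℝ) (hz4 : 0 < z4)
    (that : ℝ) (hthat : that = tbar - Real.pi / (u1hi - u1lo))
    (x : ℝ → ℝ × ℝ × ℝ × ℝ)
    (hx : ∀ t ∈ Icc that tbar, HasDerivAt x (robotF (x t) (u1hi, u2lo)) t)
    (hxT : x tbar = (1, z2, Real.pi / 2, z4))
    (lam3 lam4 : ℝ → ℝ)
    (hlam3 : ∀ t, lam3 t = -∫ s in t..tbar, (x s).2.2.2 * Real.sin ((x s).2.2.1))
    (hlam4 : ∀ t, lam4 t = ∫ s in t..tbar, Real.cos ((x s).2.2.1)) :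
    ∀ t ∈ Ioo that tbar,
      lam3 t < 0 ∧ 0 < lam4 t ∧
      ∀ u ∈ Icc u1lo u1hi ×ˢ Icc u2lo u2hi,
        (x t).2.2.2 * Real.cos ((x t).2.2.1) + lam3 t * u1hi + lam4 t * u2lo ≤
        (x t).2.2.2 * Real.cos ((x t).2.2.1) + lam3 t * u.1 + lam4 t * u.2 := by
  have h3 : ∀ s ∈ Icc that tbar, (x s).2.2.1 = Real.pi / 2 + u1hi * (s - tbar) := fun s hs => by
    simpa [hxT] using eq_add_mul_of_hasDerivAt_const
      (f := fun r => (x r).2.2.1) (fun r hr => (hx r hr).snd.snd.fst) hs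
  have h4 : ∀ s ∈ Icc that tbar, (x s).2.2.2 = z4 + u2lo * (s - tbar) := fun s hs => by
    simpa [hxT] using eq_add_mul_of_hasDerivAt_const
      (f := fun r => (x r).2.2.2) (fun r hr => (hx r hr).snd.snd.snd) hs
  have hcont : ContinuousOn x (Icc that tbar) := fun s hs =>
    (hx s hs).continuousAt.continuousWithinAt
  have hangle : ∀ s ∈ Ioo that tbar, (x s).2.2.1 ∈ Ioo 0 (Real.pi / 2) := by
    intro s hs
    rw [h3 s (Ioo_subset_Icc_self hs)]
    have hd : 0 < u1hi - u1lo := by linarith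
    have hlt : tbar - s < Real.pi / (u1hi - u1lo) := by linarith [hs.1]
    rw [lt_div_iff₀ hd] at hlt
    constructor <;> nlinarith [hs.2]
  have hspeed : ∀ s ∈ Ioo that tbar, 0 < (x s).2.2.2 := by
    intro s hs
    rw [h4 s (Ioo_subset_Icc_self hs)]
    nlinarith [hs.2]
  intro t ht
  have hsub : uIcc t tbar ⊆ Icc that tbar := by
    rw [uIcc_of_le ht.2.le]
    exact Icc_subset_Icc_left ht.1.le
  have hcont' := hcont.mono hsub
  have hneg : lam3 t < 0 := by
    rw [hlam3, neg_lt_zero]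
    refine intervalIntegral_pos_of_pos_on (ContinuousOn.intervalIntegrable (by fun_prop))
      (fun s hs => ?_) ht.2
    have hs' : s ∈ Ioo that tbar := ⟨ht.1.trans hs.1, hs.2⟩
    have ha := hangle s hs'
    exact mul_pos (hspeed s hs')
      (Real.sin_pos_of_pos_of_lt_pi ha.1 (by linarith [ha.2, Real.pi_pos]))
  have hpos : 0 < lam4 t := by
    rw [hlam4]
    refine intervalIntegral_pos_of_pos_on (ContinuousOn.intervalIntegrable (by fun_prop))
      (fun s hs => ?_) ht.2
    have ha := hangle s ⟨ht.1.trans hs.1, hs.2⟩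
    exact Real.cos_pos_of_mem_Ioo ⟨by linarith [ha.1, Real.pi_pos], ha.2⟩
  refine ⟨hneg, hpos, fun u hu => ?_⟩
  have hu1 := mul_le_mul_of_nonpos_left hu.1.2 hneg.le
  have hu2 := mul_le_mul_of_nonneg_left hu.2.1 hpos.le
  linarith
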